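/- Let w₀, w₁, w₂, w₃ ∈ M₂(ℂ) be Hermitian matrices with g(w_λ, w_μ) = η_{λμ} for all λ, μ ∈ {0,1,2,3}, with tr(w₀) > 0, and such that the real 4×4 matrix L with entries L_{λμ} := η_{λλ}·Re(g(τ_λ, w_μ)) satisfies det L = 1 (i.e. the frame (w_λ) is orthonormal, future time-oriented and positively oriented). Then there exists K ∈ M₂(ℂ) with det K = 1 and w_λ = K·τ_λ·Kᴴ for every λ = 0,1,2,3. -/

import Mathlib

open Matrix

/-- The space of 2×2 complex matrices. -/
abbrev M2 : Type := Matrix (Fin 2) (Fin 2) ℂ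

/-- The (complexified) Lorentz metric: `g(y,y') = tr y · tr y' − tr (y·y')`. -/
noncomputable def minkG (y y' : M2) : ℂ := y.trace * y'.trace - (y * y').trace

/-- The Pauli matrices `σ₀ = I₂, σ₁, σ₂, σ₃`. -/
noncomputable def pauli : Fin 4 → M2 :=
  ![1, !![0, 1; 1, 0], !![0, -Complex.I; Complex.I, 0], !![1, 0; 0, -1]]

/-- The Pauli basis of the Minkowski space of Hermitian 2×2 matrices: `τ_λ = σ_λ/√2`. -/
noncomputable def tau (l : Fin 4) : M2 := ((Real.sqrt 2 : ℂ))⁻¹ • pauli l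

/-- The Minkowski matrix `η = diag(1,−1,−1,−1)`. -/
def eta (l m : Fin 4) : ℝ := if l = m then (if l = 0 then 1 else -1) else 0

open ComplexConjugate

/-- Hermitian matrix with given real Pauli coordinates. -/
noncomputable def hmat (p : Fin 4 → ℝ) : M2 :=
  !![(p 0 : ℂ) + p 3, (p 1 : ℂ) - Complex.I * p 2; (p 1 : ℂ) + Complex.I * p 2, (p 0 : ℂ) - p 3]

lemma exists_hmat (w : M2) (h : w.IsHermitian) : ∃ p, w = hmat p := by
  have h00 := congrArg Complex.im (h.apply 0 0)
  have h11 := congrArg Complex.im (h.apply 1 1)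
  have h01r := congrArg Complex.re (h.apply 0 1)
  have h01i := congrArg Complex.im (h.apply 0 1)
  simp at h00 h11 h01r h01i
  refine ⟨![((w 0 0).re + (w 1 1).re) / 2, (w 0 1).re, - (w 0 1).im,
    ((w 0 0).re - (w 1 1).re) / 2], ?_⟩
  ext i j
  fin_cases i <;> fin_cases j <;> apply Complex.ext <;> simp [hmat] <;> linarith

lemma minkG_hmat (p q : Fin 4 → ℝ) :
    minkG (hmat p) (hmat q) = ((2 * (p 0 * q 0 - p 1 * q 1 - p 2 * q 2 - p 3 * q 3) : ℝ) : ℂ) := by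
  simp [minkG, hmat, Matrix.trace_fin_two, Matrix.mul_apply, Fin.sum_univ_two]
  ring_nf
  simp only [Complex.I_sq]
  ring

lemma minkG_conj (K a b : M2) (hK : K.det = 1) :
    minkG (K * a * Kᴴ) (K * b * Kᴴ) = minkG a b := by
  have h1 : Kᴴ.det = 1 := by rw [det_conjTranspose, hK]; simp
  have key : minkG (K * a * Kᴴ) (K * b * Kᴴ) = K.det * Kᴴ.det * minkG a b := by
    generalize Kᴴ = J
    simp only [minkG, Matrix.trace_fin_two, Matrix.mul_apply, Fin.sum_univ_two, det_fin_two]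
    ring
  rw [key, hK, h1]; ring

/-- The (complex) volume expression. -/
noncomputable def vol (a b c d : M2) : ℂ := (a * b.adjugate * c * d.adjugate).trace

lemma vol_conj (K a b c d : M2) (hK : K.det = 1) :
    vol (K * a * Kᴴ) (K * b * Kᴴ) (K * c * Kᴴ) (K * d * Kᴴ) = vol a b c d := by
  have h1 : Kᴴ.det = 1 := by rw [det_conjTranspose, hK]; simp
  have e1 : ∀ X, Kᴴ * (Kᴴ.adjugate * X) = X := by
    intro X; rw [← Matrix.mul_assoc, mul_adjugate, h1]; simp
  have e2 : ∀ X, K.adjugate * (K * X) = X := by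
    intro X; rw [← Matrix.mul_assoc, adjugate_mul, hK]; simp
  unfold vol
  simp only [adjugate_mul_distrib, Matrix.mul_assoc, e1, e2]
  rw [Matrix.trace_mul_comm]
  simp only [Matrix.mul_assoc, adjugate_mul, hK]
  simp

lemma vol_hmat (p q r s : Fin 4 → ℝ) :
    (vol (hmat p) (hmat q) (hmat r) (hmat s)).im = 2 * (Matrix.of ![p, q, r, s]).det := by
  simp [vol, hmat, adjugate_fin_two, Matrix.trace_fin_two, det_succ_row_zero, Fin.sum_univ_succ,
    Fin.succAbove]
  ring

lemma inv_sqrt_two_sq : ((Real.sqrt 2 : ℂ))⁻¹ * ((Real.sqrt 2 : ℂ))⁻¹ = 1 / 2 := by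
  rw [← mul_inv, ← Complex.ofReal_mul, Real.mul_self_sqrt (by norm_num)]; norm_num

lemma orient_hmat (p : Fin 4 → Fin 4 → ℝ) :
    (Matrix.of fun l m : Fin 4 => eta l l * (minkG (tau l) (hmat (p m))).re).det =
      2 * (vol (hmat (p 0)) (hmat (p 1)) (hmat (p 2)) (hmat (p 3))).im := by
  have hs : (Real.sqrt 2) ^ 4 = 4 := by
    have : (Real.sqrt 2)^2 = 2 := Real.sq_sqrt (by norm_num)
    calc _ = ((Real.sqrt 2)^2)^2 := by ring
      _ = 4 := by rw [this]; norm_num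
  have hi : (Real.sqrt 2)⁻¹ * 2 = Real.sqrt 2 := by
    have : (Real.sqrt 2)^2 = 2 := Real.sq_sqrt (by norm_num)
    field_simp; linarith
  have : (Matrix.of fun l m : Fin 4 => eta l l * (minkG (tau l) (hmat (p m))).re) =
      Real.sqrt 2 • (Matrix.of ![p 0, p 1, p 2, p 3])ᵀ := by
    have hp : (Matrix.of ![p 0, p 1, p 2, p 3]) = Matrix.of p := by
      ext i j; fin_cases i <;> rfl
    rw [hp]
    ext l m
    simp only [Matrix.of_apply, Matrix.smul_apply, Matrix.transpose_apply, smul_eq_mul]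
    rw [← hi]
    have hc : ((Real.sqrt 2 : ℂ))⁻¹ = (((Real.sqrt 2)⁻¹ : ℝ) : ℂ) := by push_cast; rfl
    fin_cases l <;>
      simp [eta, minkG, tau, pauli, hmat, hc, Matrix.trace_fin_two, Matrix.mul_apply,
        Fin.sum_univ_two, -Complex.ofReal_inv] <;> ring
  rw [this, det_smul, det_transpose, vol_hmat]
  simp only [Fintype.card_fin, hs]; ring

/-- A null Hermitian matrix is plus or minus a rank-one projector `k kᴴ`. -/
lemma null_decomp (p : Fin 4 → ℝ) (h : minkG (hmat p) (hmat p) = 0) :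
    ∃ (s : ℝ) (x y : ℂ), (s = 1 ∨ s = -1) ∧
      hmat p = (s : ℂ) • !![x * conj x, x * conj y; y * conj x, y * conj y] := by
  rw [minkG_hmat] at h
  have h' : p 0 * p 0 - p 1 * p 1 - p 2 * p 2 - p 3 * p 3 = 0 := by
    have := Complex.ofReal_eq_zero.1 h; linarith
  obtain ⟨s, hs, hs0⟩ : ∃ s : ℝ, (s = 1 ∨ s = -1) ∧ 0 ≤ s * p 0 := by
    rcases le_total 0 (p 0) with h0 | h0
    · exact ⟨1, Or.inl rfl, by linarith⟩
    · exact ⟨-1, Or.inr rfl, by linarith⟩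
  have hss : s * s = 1 := by rcases hs with rfl | rfl <;> norm_num
  refine ⟨s, ?_⟩
  have h3 : (s * p 3)^2 ≤ (s * p 0)^2 := by
    have : (s*p 0)^2 - (s*p 3)^2 = (s*s) * (p 1^2 + p 2 ^2) := by linear_combination s^2 * h'
    rw [hss] at this; nlinarith [sq_nonneg (p 1), sq_nonneg (p 2)]
  have h4 := abs_le_of_sq_le_sq' h3 hs0
  rcases eq_or_lt_of_le (show 0 ≤ s * p 0 + s * p 3 by linarith) with ha | ha
  · have hp3 : p 3 = - p 0 := by
      have : s * (s * p 0 + s * p 3) = 0 := by rw [← ha]; ring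
      linear_combination this - (p 0 + p 3) * hss
    have hz : p 1 ^ 2 + p 2 ^ 2 = 0 := by rw [hp3] at h'; linarith
    have hp1 : p 1 = 0 := by nlinarith [sq_nonneg (p 1), sq_nonneg (p 2)]
    have hp2 : p 2 = 0 := by nlinarith [sq_nonneg (p 1), sq_nonneg (p 2)]
    refine ⟨0, (Real.sqrt (2 * (s * p 0)) : ℝ), hs, ?_⟩
    have hq : ((Real.sqrt (2 * (s * p 0)) : ℝ) : ℂ) * (Real.sqrt (2 * (s * p 0)) : ℝ)
      = ((2 * (s * p 0) : ℝ) : ℂ) := by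
      rw [← Complex.ofReal_mul, Real.mul_self_sqrt (by linarith)]
    have hssC : (s : ℂ) * s = 1 := by exact_mod_cast hss
    ext i j
    fin_cases i <;> fin_cases j <;> simp [hmat, hp1, hp2, hp3]
    simp at hq
    rw [hq]; linear_combination (-2 * (p 0 : ℂ)) * hssC
  · set a := s * p 0 + s * p 3 with haa
    have hr : 0 < Real.sqrt a := Real.sqrt_pos.2 ha
    have hq : ((Real.sqrt a : ℝ) : ℂ) * (Real.sqrt a : ℝ) = (a : ℂ) := by
      rw [← Complex.ofReal_mul, Real.mul_self_sqrt ha.le]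
    have hne : ((Real.sqrt a : ℝ) : ℂ) ≠ 0 := by exact_mod_cast hr.ne'
    have haC : (a : ℂ) = s * p 0 + s * p 3 := by rw [haa]; push_cast; rfl
    have hssC : (s : ℂ) * s = 1 := by exact_mod_cast hss
    have hC : (p 0 : ℂ) * p 0 - p 1 * p 1 - p 2 * p 2 - p 3 * p 3 = 0 := by exact_mod_cast h'
    refine ⟨(Real.sqrt a : ℝ), s * (p 1 + Complex.I * p 2) / (Real.sqrt a : ℝ), hs, ?_⟩
    ext i j
    fin_cases i <;> fin_cases j <;> simp [hmat]
    · rw [hq, haC]; linear_combination (-(p 0 : ℂ) - p 3) * hssC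
    · field_simp; linear_combination (-(p 1 : ℂ) + Complex.I * p 2) * hssC
    · field_simp; linear_combination (-(p 1 : ℂ) - Complex.I * p 2) * hssC
    · field_simp
      rw [pow_two (Real.sqrt a : ℂ), hq, haC]
      have hs3 : (s : ℂ) ^ 3 = s := by linear_combination (s : ℂ) * hssC
      rw [hs3]
      linear_combination (s : ℂ) * hC + s * (p 2 : ℂ)^2 * Complex.I_sq

/-- Adapting a unit-determinant matrix to `w₀` and `w₃`. -/
lemma exists_adapted (p q : Fin 4 → ℝ)
    (hpp : minkG (hmat p) (hmat p) = 1) (hqq : minkG (hmat q) (hmat q) = -1)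
    (hpq : minkG (hmat p) (hmat q) = 0) (ht : 0 < p 0) :
    ∃ K : M2, K.det = 1 ∧ hmat p = K * tau 0 * Kᴴ ∧ hmat q = K * tau 3 * Kᴴ := by
  rw [minkG_hmat] at hpp hqq hpq
  have hpp' : 2 * (p 0 * p 0 - p 1 * p 1 - p 2 * p 2 - p 3 * p 3) = 1 := by exact_mod_cast hpp
  have hqq' : 2 * (q 0 * q 0 - q 1 * q 1 - q 2 * q 2 - q 3 * q 3) = -1 := by exact_mod_cast hqq
  have hpq' : 2 * (p 0 * q 0 - p 1 * q 1 - p 2 * q 2 - p 3 * q 3) = 0 := by exact_mod_cast hpq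
  obtain ⟨s, x, y, hs, hn⟩ := null_decomp (p + q) (by
    rw [minkG_hmat]; norm_cast; simp only [Pi.add_apply]; linarith)
  obtain ⟨t, z, u, ht', hm⟩ := null_decomp (p - q) (by
    rw [minkG_hmat]; norm_cast; simp only [Pi.sub_apply]; linarith)
  have hnm : minkG (hmat (p + q)) (hmat (p - q)) = 2 := by
    rw [minkG_hmat]; norm_cast; simp only [Pi.add_apply, Pi.sub_apply]; linarith
  have hdet : (s : ℂ) * t * ((x * u - y * z) * conj (x * u - y * z)) = 2 := by
    rw [← hnm, hn, hm]
    simp [minkG, Matrix.trace_fin_two]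
    ring
  have hdet' : s * t * Complex.normSq (x * u - y * z) = 2 := by
    rw [Complex.mul_conj] at hdet; exact_mod_cast hdet
  have hnn := Complex.normSq_nonneg (x * u - y * z)
  have htr1 : 2 * (p 0 + q 0) = s * (Complex.normSq x + Complex.normSq y) := by
    have := congrArg Matrix.trace hn
    simp [hmat, Matrix.trace_fin_two, Complex.mul_conj] at this
    have h2 : 2 * ((p 0 : ℂ) + q 0) = s * (Complex.normSq x + Complex.normSq y) := by
      linear_combination this
    exact_mod_cast h2
  have htr2 : 2 * (p 0 - q 0) = t * (Complex.normSq z + Complex.normSq u) := by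
    have := congrArg Matrix.trace hm
    simp [hmat, Matrix.trace_fin_two, Complex.mul_conj] at this
    have h2 : 2 * ((p 0 : ℂ) - q 0) = t * (Complex.normSq z + Complex.normSq u) := by
      linear_combination this
    exact_mod_cast h2
  have hx := Complex.normSq_nonneg x
  have hy := Complex.normSq_nonneg y
  have hz := Complex.normSq_nonneg z
  have hu := Complex.normSq_nonneg u
  have hst : s = 1 ∧ t = 1 := by
    rcases hs with rfl | rfl <;> rcases ht' with rfl | rfl
    · exact ⟨rfl, rfl⟩
    · linarith
    · linarith
    · linarith
  obtain ⟨rfl, rfl⟩ := hst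
  -- normalisation: `r = 2^{-1/4}`
  obtain ⟨r, hr⟩ : ∃ r : ℝ, r * r = (Real.sqrt 2)⁻¹ :=
    ⟨Real.sqrt (Real.sqrt 2)⁻¹, Real.mul_self_sqrt (by positivity)⟩
  have hrC : (r : ℂ) * r = ((Real.sqrt 2 : ℂ))⁻¹ := by exact_mod_cast congrArg Complex.ofReal hr
  have h2 := inv_sqrt_two_sq
  set D := x * u - y * z with hD
  have hDD : D * conj D = 2 := by simpa using hdet
  -- unit phase
  set f : ℂ := ((Real.sqrt 2 : ℂ))⁻¹ * conj D with hf
  have hff : f * conj f = 1 := by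
    rw [hf]; simp
    linear_combination D * conj D * h2 + 1/2 * hDD
  have hr4 : (r : ℂ) ^ 4 = 1 / 2 := by
    rw [← h2, ← hrC]; ring
  have hfD : D * f = (Real.sqrt 2 : ℂ) ⁻¹ * 2 := by rw [hf]; linear_combination (Real.sqrt 2 : ℂ)⁻¹ * hDD
  clear_value f
  refine ⟨!![r * x, r * z * f; r * y, r * u * f], ?_, ?_, ?_⟩
  · rw [det_fin_two_of]
    linear_combination (D * f) * hrC + (Real.sqrt 2 : ℂ)⁻¹ * hfD + 2 * h2
  · have e : hmat p = (1/2 : ℂ) • (hmat (p + q) + hmat (p - q)) := by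
      ext i j; fin_cases i <;> fin_cases j <;> simp [hmat] <;> ring
    rw [e, hn, hm]
    ext i j
    fin_cases i <;> fin_cases j <;>
      simp [tau, pauli, Matrix.mul_apply, Fin.sum_univ_two, ← hrC, -mul_eq_mul_left_iff, -mul_eq_mul_right_iff]
    · linear_combination (-(x * conj x) - (z * conj z) * (f * conj f)) * hr4 - 1 / 2 * (z * conj z) * hff
    · linear_combination (-(x * conj y) - (z * conj u) * (f * conj f)) * hr4 - 1 / 2 * (z * conj u) * hff
    · linear_combination (-(y * conj x) - (u * conj z) * (f * conj f)) * hr4 - 1 / 2 * (u * conj z) * hff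
    · linear_combination (-(y * conj y) - (u * conj u) * (f * conj f)) * hr4 - 1 / 2 * (u * conj u) * hff
  · have e : hmat q = (1/2 : ℂ) • (hmat (p + q) - hmat (p - q)) := by
      ext i j; fin_cases i <;> fin_cases j <;> simp [hmat] <;> ring
    rw [e, hn, hm]
    ext i j
    fin_cases i <;> fin_cases j <;>
      simp [tau, pauli, Matrix.mul_apply, Fin.sum_univ_two, ← hrC, -mul_eq_mul_left_iff, -mul_eq_mul_right_iff]
    · linear_combination (-(x * conj x) + (z * conj z) * (f * conj f)) * hr4 + 1 / 2 * (z * conj z) * hff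
    · linear_combination (-(x * conj y) + (z * conj u) * (f * conj f)) * hr4 + 1 / 2 * (z * conj u) * hff
    · linear_combination (-(y * conj x) + (u * conj z) * (f * conj f)) * hr4 + 1 / 2 * (u * conj z) * hff
    · linear_combination (-(y * conj y) + (u * conj u) * (f * conj f)) * hr4 + 1 / 2 * (u * conj u) * hff

lemma diag_conj (e : ℂ) (b : M2) :
    (!![e, 0; 0, conj e] : M2) * b * (!![e, 0; 0, conj e] : M2)ᴴ =
      !![e * b 0 0 * conj e, e * b 0 1 * e; conj e * b 1 0 * conj e, conj e * b 1 1 * e] := by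
  ext i j
  fin_cases i <;> fin_cases j <;> simp [Matrix.mul_apply, Matrix.vecMul, dotProduct, Fin.sum_univ_two]

set_option maxHeartbeats 4000000 in
/-- Every `g`-orthonormal, future time-oriented, positively oriented frame `(w_λ)` of the
Minkowski space of Hermitian 2×2 matrices is obtained from the Pauli basis by
`w_λ = K·τ_λ·Kᴴ` for some `K` of unit determinant (i.e. comes from a normalized
two-spinor basis). -/
theorem exists_normalized_spinor_basis (w : Fin 4 → M2)
    (hherm : ∀ l, (w l).IsHermitian)
    (horth : ∀ l m, minkG (w l) (w m) = (eta l m : ℂ))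
    (htime : 0 < ((w 0).trace).re)
    (horient :
      (Matrix.of fun l m : Fin 4 => eta l l * (minkG (tau l) (w m)).re).det = 1) :
    ∃ K : M2, K.det = 1 ∧ ∀ l, w l = K * tau l * Kᴴ := by
  choose p hp using fun l => exists_hmat (w l) (hherm l)
  have hp0 : 0 < p 0 0 := by
    have := htime
    rw [hp 0] at this
    simp [hmat, Matrix.trace_fin_two] at this
    linarith
  have ho := horth
  have hT : (vol (w 0) (w 1) (w 2) (w 3)).im = 1 / 2 := by
    have h := horient
    simp only [hp] at h
    rw [orient_hmat] at h
    simp only [← hp] at h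
    linarith
  obtain ⟨K, hK, hK0, hK3⟩ := exists_adapted (p 0) (p 3)
    (by rw [← hp, horth]; simp [eta]) (by rw [← hp, horth]; simp [eta])
    (by rw [← hp, ← hp, horth]; simp [eta]) hp0
  rw [← hp] at hK0 hK3
  have hKJ : Kᴴ.det = 1 := by rw [det_conjTranspose, hK]; simp
  have hpull : ∀ a : M2, a.IsHermitian → ∃ q, a = K * hmat q * Kᴴ := by
    intro a ha
    have hA : (K.adjugate * a * K.adjugateᴴ).IsHermitian := by
      simp [Matrix.IsHermitian, conjTranspose_mul, ha.eq, Matrix.mul_assoc]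
    obtain ⟨q, hq⟩ := exists_hmat _ hA
    refine ⟨q, ?_⟩
    have e1 : K * K.adjugate = 1 := by rw [mul_adjugate, hK, one_smul]
    have e2 : K.adjugateᴴ * Kᴴ = 1 := by rw [← conjTranspose_mul, e1, conjTranspose_one]
    rw [← hq]
    calc a = (K * K.adjugate) * a * (K.adjugateᴴ * Kᴴ) := by rw [e1, e2]; simp
      _ = _ := by simp only [Matrix.mul_assoc]
  obtain ⟨q1, hq1⟩ := hpull (w 1) (hherm 1)
  obtain ⟨q2, hq2⟩ := hpull (w 2) (hherm 2)
  have hsp : (0 : ℝ) < (Real.sqrt 2)⁻¹ := by positivity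
  have hss : (Real.sqrt 2)⁻¹ * (Real.sqrt 2)⁻¹ = 1 / 2 := by
    rw [← mul_inv, Real.mul_self_sqrt (by norm_num)]; norm_num
  have ht0 : tau 0 = hmat ![(Real.sqrt 2)⁻¹, 0, 0, 0] := by
    ext i j; fin_cases i <;> fin_cases j <;> simp [tau, pauli, hmat]
  have ht3 : tau 3 = hmat ![0, 0, 0, (Real.sqrt 2)⁻¹] := by
    ext i j; fin_cases i <;> fin_cases j <;> simp [tau, pauli, hmat]
  rw [ht0] at hK0
  rw [ht3] at hK3
  rw [hK0, hq1, hq2, hK3, vol_conj _ _ _ _ _ hK, vol_hmat] at hT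
  have o01 := horth 0 1
  have o02 := horth 0 2
  have o31 := horth 3 1
  have o32 := horth 3 2
  have o11 := horth 1 1
  have o12 := horth 1 2
  have o22 := horth 2 2
  rw [hK0, hq1, minkG_conj _ _ _ hK, minkG_hmat] at o01
  rw [hK0, hq2, minkG_conj _ _ _ hK, minkG_hmat] at o02
  rw [hK3, hq1, minkG_conj _ _ _ hK, minkG_hmat] at o31
  rw [hK3, hq2, minkG_conj _ _ _ hK, minkG_hmat] at o32
  rw [hq1, minkG_conj _ _ _ hK, minkG_hmat] at o11
  rw [hq1, hq2, minkG_conj _ _ _ hK, minkG_hmat] at o12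
  rw [hq2, minkG_conj _ _ _ hK, minkG_hmat] at o22
  have o01 := Complex.ofReal_injective o01
  have o02 := Complex.ofReal_injective o02
  have o31 := Complex.ofReal_injective o31
  have o32 := Complex.ofReal_injective o32
  have o11 := Complex.ofReal_injective o11
  have o12 := Complex.ofReal_injective o12
  have o22 := Complex.ofReal_injective o22
  simp [eta] at o01 o02 o31 o32 o11 o12 o22
  simp [o01, o02, o31, o32] at o11 o12 o22
  simp [det_succ_row_zero, Fin.sum_univ_succ, Fin.succAbove, o01, o02, o31, o32] at hT
  have hA : q1 1 * q2 2 - q1 2 * q2 1 = 1 / 2 := by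
    linear_combination hT - 2 * (q1 1 * q2 2 - q1 2 * q2 1) * hss
  have hsum : (q1 1 - q2 2) ^ 2 + (q1 2 + q2 1) ^ 2 = 0 := by nlinarith
  have h22 : q2 2 = q1 1 := by
    have : (q1 1 - q2 2) ^ 2 = 0 := by nlinarith [sq_nonneg (q1 1 - q2 2), sq_nonneg (q1 2 + q2 1)]
    have := pow_eq_zero_iff (two_ne_zero) |>.1 this
    linarith
  have h21 : q2 1 = - q1 2 := by
    have : (q1 2 + q2 1) ^ 2 = 0 := by nlinarith [sq_nonneg (q1 1 - q2 2), sq_nonneg (q1 2 + q2 1)]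
    have := pow_eq_zero_iff (two_ne_zero) |>.1 this
    linarith
  have hn1 : q1 1 ^ 2 + q1 2 ^ 2 = 1 / 2 := by nlinarith
  -- square root of the phase
  obtain ⟨e, he⟩ : ∃ e : ℂ, e * e = (Real.sqrt 2 : ℂ) * (q1 1 - Complex.I * q1 2) := by
    obtain ⟨e, he⟩ := IsAlgClosed.exists_pow_nat_eq
      ((Real.sqrt 2 : ℂ) * (q1 1 - Complex.I * q1 2)) (n := 2) (by norm_num)
    exact ⟨e, by rw [← he]; ring⟩
  have hec : conj e * conj e = (Real.sqrt 2 : ℂ) * (q1 1 + Complex.I * q1 2) := by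
    rw [← map_mul, he]; simp
  have hs2 : (Real.sqrt 2 : ℂ) * (Real.sqrt 2 : ℂ) = 2 := by
    rw [← Complex.ofReal_mul, Real.mul_self_sqrt (by norm_num)]; norm_num
  have hsi : (Real.sqrt 2 : ℂ)⁻¹ * (Real.sqrt 2 : ℂ) = 1 :=
    inv_mul_cancel₀ (by exact_mod_cast (Real.sqrt_pos.2 (by norm_num : (0:ℝ) < 2)).ne')
  have hee : e * conj e = 1 := by
    have hsq : (e * conj e) * (e * conj e) = 1 := by
      have hn1C : (q1 1 : ℂ) ^ 2 + (q1 2 : ℂ) ^ 2 = 1 / 2 := by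
        have := congrArg Complex.ofReal hn1
        push_cast at this
        exact this
      calc (e * conj e) * (e * conj e) = (e * e) * (conj e * conj e) := by ring
        _ = (Real.sqrt 2 : ℂ) * (Real.sqrt 2 : ℂ) *
            ((q1 1 : ℂ) ^ 2 - Complex.I ^ 2 * (q1 2 : ℂ) ^ 2) := by rw [he, hec]; ring
        _ = 1 := by rw [hs2, Complex.I_sq]; linear_combination 2 * hn1C
    rw [Complex.mul_conj] at hsq ⊢
    have h' : Complex.normSq e * Complex.normSq e = 1 := by exact_mod_cast hsq
    have : Complex.normSq e = 1 := by nlinarith [Complex.normSq_nonneg e]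
    rw [this]; simp
  have hec' : conj e * e = 1 := by rw [mul_comm]; exact hee
  set U : M2 := !![e, 0; 0, conj e] with hU
  have hUd : U.det = 1 := by rw [hU, det_fin_two_of]; simp [hee]
  have hfin : ∀ a b : M2, a = U * b * Uᴴ → K * a * Kᴴ = (K * U) * b * (K * U)ᴴ := by
    intro a b h
    rw [h, conjTranspose_mul]; simp only [Matrix.mul_assoc]
  refine ⟨K * U, by rw [det_mul, hK, hUd, one_mul], ?_⟩
  intro l
  fin_cases l
  · change w 0 = K * U * tau 0 * (K * U)ᴴ
    rw [hK0, ← ht0]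
    apply hfin
    rw [hU, diag_conj]
    ext i j; fin_cases i <;> fin_cases j <;> simp [tau, pauli, hU]
    · linear_combination (-(Real.sqrt 2 : ℂ)⁻¹) * hee
    · linear_combination (-(Real.sqrt 2 : ℂ)⁻¹) * hee
  · change w 1 = K * U * tau 1 * (K * U)ᴴ
    rw [hq1]
    apply hfin
    rw [hU, diag_conj]
    ext i j; fin_cases i <;> fin_cases j <;> simp [tau, pauli, hU, hmat, o01, o31]
    · linear_combination (-(Real.sqrt 2 : ℂ)⁻¹) * he - (q1 1 - Complex.I * q1 2) * hsi
    · linear_combination (-(Real.sqrt 2 : ℂ)⁻¹) * hec - (q1 1 + Complex.I * q1 2) * hsi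
  · change w 2 = K * U * tau 2 * (K * U)ᴴ
    rw [hq2]
    apply hfin
    rw [hU, diag_conj]
    ext i j; fin_cases i <;> fin_cases j <;> simp [tau, pauli, hU, hmat, o02, o32, h21, h22]
    · linear_combination (Complex.I * (Real.sqrt 2 : ℂ)⁻¹) * he +
        Complex.I * (q1 1 - Complex.I * q1 2) * hsi - (q1 2 : ℂ) * Complex.I_sq
    · linear_combination (-Complex.I * (Real.sqrt 2 : ℂ)⁻¹) * hec -
        Complex.I * (q1 1 + Complex.I * q1 2) * hsi - (q1 2 : ℂ) * Complex.I_sq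
  · change w 3 = K * U * tau 3 * (K * U)ᴴ
    rw [hK3, ← ht3]
    apply hfin
    rw [hU, diag_conj]
    ext i j; fin_cases i <;> fin_cases j <;> simp [tau, pauli, hU]
    · linear_combination (-(Real.sqrt 2 : ℂ)⁻¹) * hee
    · linear_combination (-(Real.sqrt 2 : ℂ)⁻¹) * hee
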